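/- arXiv:1507.08354 — 5 statements merged into one kernel-verified Lean document; each statement's English description precedes it below -/
import Mathlib

section
/- Let a = (a_0, a_1, …, a_c) be a determining vector, let γ = K(a) be its Betti diagram, and let p be a positive integer. If p·γ = Σ_{k=1}^{p} K(a^{(k)}) for determining vectors a^{(1)}, a^{(2)}, …, a^{(p)}, then K(a^{(k)}) = γ for every k = 1, …, p. -/
/-- The Betti diagram of the complete intersection with determining vector
`(a0, a 0, …, a (c-1))`: the entry at `(i, d)` counts the subsets `S ⊆ {1,…,c}`
with `|S| = i` and `a0 + Σ_{ℓ ∈ S} a ℓ = d`. -/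
def bettiCI (c : ℕ) (a0 : ℤ) (a : Fin c → ℤ) : ℕ × ℤ → ℤ := fun p =>
  ((Finset.univ.filter fun S : Finset (Fin c) =>
      S.card = p.1 ∧ a0 + ∑ ℓ ∈ S, a ℓ = p.2).card : ℤ)

/-- The degrees part of a determining vector: entries are at least 1 and nondecreasing. -/
def IsDetVec {c : ℕ} (a : Fin c → ℤ) : Prop := (∀ j, 1 ≤ a j) ∧ Monotone a

/-- Summing `f` over the degrees of column `i` of a Betti diagram, with multiplicities, is summing
`f` over the degree shifts of the `i`-element subsets. -/
lemma sum_bettiCI_mul {c : ℕ} {a0 : ℤ} {a : Fin c → ℤ} (i : ℕ) (f : ℤ → ℝ) (D : Finset ℤ)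
    (hD : ∀ S : Finset (Fin c), a0 + ∑ l ∈ S, a l ∈ D) :
    ∑ d ∈ D, (bettiCI c a0 a (i, d) : ℝ) * f d =
      ∑ S ∈ Finset.powersetCard i Finset.univ, f (a0 + ∑ l ∈ S, a l) := by
  rw [← Finset.sum_fiberwise_of_maps_to (t := D) (g := fun S => a0 + ∑ l ∈ S, a l)
    (fun S _ => hD S)]
  refine Finset.sum_congr rfl fun d _ => ?_
  rw [Finset.sum_congr rfl (g := fun _ => f d)
    (fun S hS => by rw [(Finset.mem_filter.1 hS).2]), Finset.sum_const, nsmul_eq_mul]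
  congr 1
  simp only [bettiCI, Int.cast_natCast, Nat.cast_inj]
  congr 1
  ext S
  simp [Finset.mem_powersetCard]

lemma sum_powersetCard_eq_of_bettiCI {p c : ℕ} {a0 : ℤ} {a : Fin c → ℤ} {c' : Fin p → ℕ}
    {b0 : Fin p → ℤ} {b : (k : Fin p) → Fin (c' k) → ℤ}
    (heq : ∀ q : ℕ × ℤ,
      (p : ℤ) * bettiCI c a0 a q = ∑ k, bettiCI (c' k) (b0 k) (b k) q) (i : ℕ) (f : ℤ → ℝ) :
    p * ∑ S ∈ Finset.powersetCard i Finset.univ, f (a0 + ∑ l ∈ S, a l) =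
      ∑ k, ∑ S ∈ Finset.powersetCard i Finset.univ, f (b0 k + ∑ l ∈ S, b k l) := by
  classical
  let D : Finset ℤ := (Finset.univ.image fun S : Finset (Fin c) => a0 + ∑ l ∈ S, a l) ∪
    Finset.univ.biUnion fun k =>
      Finset.univ.image fun S : Finset (Fin (c' k)) => b0 k + ∑ l ∈ S, b k l
  have hDa : ∀ S : Finset (Fin c), a0 + ∑ l ∈ S, a l ∈ D := fun S =>
    Finset.mem_union_left _ (Finset.mem_image_of_mem _ (Finset.mem_univ S))
  have hDb : ∀ k, ∀ S : Finset (Fin (c' k)), b0 k + ∑ l ∈ S, b k l ∈ D := fun k S =>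
    Finset.mem_union_right _ (Finset.mem_biUnion.2
      ⟨k, Finset.mem_univ k, Finset.mem_image_of_mem _ (Finset.mem_univ S)⟩)
  rw [← sum_bettiCI_mul i f D hDa,
    Finset.sum_congr rfl fun k _ => (sum_bettiCI_mul i f D (hDb k)).symm,
    Finset.sum_comm, Finset.mul_sum]
  refine Finset.sum_congr rfl fun d _ => ?_
  have h : (p : ℝ) * bettiCI c a0 a (i, d) = ∑ k, (bettiCI (c' k) (b0 k) (b k) (i, d) : ℝ) :=
    mod_cast heq (i, d)
  rw [← mul_assoc, h, Finset.sum_mul]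

lemma sq_sum_eq_sum_sq_add_two_mul_sum_powersetCard {ι : Type*} (s : Finset ι)
    (y : ι → ℝ) :
    (∑ i ∈ s, y i) ^ 2 =
      ∑ i ∈ s, y i ^ 2 + 2 * ∑ S ∈ Finset.powersetCard 2 s, ∏ i ∈ S, y i := by
  classical
  induction s using Finset.induction_on with
  | empty => simp [Finset.powersetCard_eq_empty.2 (show (∅ : Finset ι).card < 2 by simp)]
  | insert j s hj ih =>
    have hdisj : Disjoint (Finset.powersetCard 2 s)
        ((Finset.powersetCard 1 s).image (insert j)) := by
      rw [Finset.disjoint_left]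
      intro S hS hS'
      obtain ⟨T, -, rfl⟩ := Finset.mem_image.1 hS'
      exact hj ((Finset.mem_powersetCard.1 hS).1 (Finset.mem_insert_self j T))
    have hmem : ∀ T ∈ Finset.powersetCard 1 s, j ∉ T := fun T hT h =>
      hj ((Finset.mem_powersetCard.1 hT).1 h)
    rw [Finset.powersetCard_succ_insert hj, Finset.sum_union hdisj,
      Finset.sum_image (fun T hT T' hT' h => by
        rw [← Finset.erase_insert (hmem T hT), h, Finset.erase_insert (hmem T' hT')]),
      Finset.sum_congr rfl fun T hT => Finset.prod_insert (hmem T hT), ← Finset.mul_sum,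
      Finset.powersetCard_one, Finset.sum_map, Finset.sum_insert hj, Finset.sum_insert hj]
    simp only [Function.Embedding.coeFn_mk, Finset.prod_singleton]
    linear_combination ih

/-- Two finite families of natural numbers with the same generating function have the same
values with the same multiplicities. -/
lemma card_filter_eq_of_sum_pow_eq {m n : ℕ} {u : Fin m → ℕ} {v : Fin n → ℕ}
    (h : ∀ x : ℝ, ∑ i, x ^ u i = ∑ i, x ^ v i) (d : ℕ) :
    (Finset.univ.filter fun i => u i = d).card = (Finset.univ.filter fun i => v i = d).card := by
  have hp : (∑ i, Polynomial.X ^ u i : Polynomial ℝ) = ∑ i, Polynomial.X ^ v i :=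
    Polynomial.funext fun x => by simpa [Polynomial.eval_finsetSum] using h x
  have hc := congrArg (fun q => Polynomial.coeff q d) hp
  simp only [Polynomial.finsetSum_coeff, Polynomial.coeff_X_pow, Finset.sum_boole,
    Nat.cast_inj] at hc
  simpa only [eq_comm] using hc

lemma sigma_eq_of_monotone_of_card_filter_eq {m n : ℕ} {a : Fin m → ℤ} {b : Fin n → ℤ}
    (ha : Monotone a) (hb : Monotone b)
    (h : ∀ d, (Finset.univ.filter fun i => a i = d).card =
      (Finset.univ.filter fun i => b i = d).card) :
    (⟨m, a⟩ : Σ n, Fin n → ℤ) = ⟨n, b⟩ := by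
  have hcount : ∀ {n : ℕ} (v : Fin n → ℤ) (d : ℤ),
      (List.ofFn v).count d = (Finset.univ.filter fun i => v i = d).card := by
    intro n v d
    rw [List.ofFn_eq_map, ← Multiset.coe_count, ← Multiset.map_coe]
    rw [Multiset.count_map]
    simp only [eq_comm (a := d)]
    rfl
  apply List.ofFn_inj'.1
  refine List.Perm.eq_of_pairwise' ha.sortedLE_ofFn.pairwise hb.sortedLE_ofFn.pairwise ?_
  exact List.perm_iff_count.2 fun d => by rw [hcount, hcount, h]

theorem stmt0 (p : ℕ) (hp : 0 < p)
    (c : ℕ) (hc : 1 ≤ c) (a0 : ℤ) (a : Fin c → ℤ) (ha : IsDetVec a)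
    (c' : Fin p → ℕ) (hc' : ∀ k, 1 ≤ c' k)
    (b0 : Fin p → ℤ) (b : (k : Fin p) → Fin (c' k) → ℤ)
    (hb : ∀ k, IsDetVec (b k))
    (heq : ∀ q : ℕ × ℤ,
      (p : ℤ) * bettiCI c a0 a q = ∑ k, bettiCI (c' k) (b0 k) (b k) q) :
    ∀ k, bettiCI (c' k) (b0 k) (b k) = bettiCI c a0 a := by
  have hb0 : ∀ k, b0 k = a0 := by
    have h := sum_powersetCard_eq_of_bettiCI heq 0 fun d => ((d - a0 : ℤ) : ℝ) ^ 2
    simp only [Finset.powersetCard_zero, Finset.sum_singleton, Finset.sum_empty, add_zero,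
      sub_self, Int.cast_zero, ne_eq, OfNat.ofNat_ne_zero, not_false_eq_true, zero_pow,
      mul_zero] at h
    intro k
    have hk := (Finset.sum_eq_zero_iff_of_nonneg fun k _ => sq_nonneg _).1 h.symm k
      (Finset.mem_univ k)
    have := pow_eq_zero_iff (two_ne_zero) |>.1 hk
    exact sub_eq_zero.1 (mod_cast this)
  have hlift : ∀ {n : ℕ} {v : Fin n → ℤ}, IsDetVec v → ∀ i, ((v i).toNat : ℤ) = v i :=
    fun hv i => Int.toNat_of_nonneg (by linarith [hv.1 i])
  have hpow : ∀ {n : ℕ} {v : Fin n → ℤ}, IsDetVec v → ∀ (x : ℝ) (S : Finset (Fin n)),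
      x ^ (a0 + ∑ l ∈ S, v l - a0).toNat = ∏ l ∈ S, x ^ (v l).toNat := by
    intro n v hv x S
    rw [add_sub_cancel_left, Finset.prod_pow_eq_pow_sum,
      ← Finset.sum_congr rfl fun i _ => hlift hv i, ← Nat.cast_sum, Int.toNat_natCast]
  have hcol (i : ℕ) (x : ℝ) : p * ∑ S ∈ Finset.powersetCard i Finset.univ,
      ∏ l ∈ S, x ^ (a l).toNat =
      ∑ k, ∑ S ∈ Finset.powersetCard i Finset.univ, ∏ l ∈ S, x ^ (b k l).toNat := by
    have h := sum_powersetCard_eq_of_bettiCI heq i fun d => x ^ (d - a0).toNat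
    simp only [hb0, hpow ha] at h
    rw [h]
    exact Finset.sum_congr rfl fun k _ => Finset.sum_congr rfl fun S _ => hpow (hb k) x S
  have hone (x : ℝ) : p * ∑ l, x ^ (a l).toNat = ∑ k, ∑ l, x ^ (b k l).toNat := by
    simpa [Finset.powersetCard_one] using hcol 1 x
  have hsq (x : ℝ) : p * (∑ l, x ^ (a l).toNat) ^ 2 =
      ∑ k, (∑ l, x ^ (b k l).toNat) ^ 2 := by
    simp only [sq_sum_eq_sum_sq_add_two_mul_sum_powersetCard, Finset.sum_add_distrib,
      ← Finset.mul_sum, ← hcol 2 x, pow_right_comm x _ 2, ← hone (x ^ 2)]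
    ring
  have hgen (k : Fin p) (x : ℝ) : ∑ l, x ^ (b k l).toNat = ∑ l, x ^ (a l).toNat := by
    have h : ∑ k, (∑ l, x ^ (b k l).toNat - ∑ l, x ^ (a l).toNat) ^ 2 = 0 := by
      simp only [sub_sq, Finset.sum_add_distrib, Finset.sum_sub_distrib, ← hsq,
        ← Finset.sum_mul, ← Finset.mul_sum, ← hone, Finset.sum_const, Finset.card_univ,
        Fintype.card_fin, nsmul_eq_mul]
      ring
    have hk := (Finset.sum_eq_zero_iff_of_nonneg fun k _ => sq_nonneg _).1 h k
      (Finset.mem_univ k)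
    exact sub_eq_zero.1 ((pow_eq_zero_iff two_ne_zero).1 hk)
  intro k
  have hsigma : (⟨c' k, b k⟩ : Σ n, Fin n → ℤ) = ⟨c, a⟩ := by
    refine sigma_eq_of_monotone_of_card_filter_eq (hb k).2 ha.2 fun d => ?_
    have hiff : ∀ {n : ℕ} {v : Fin n → ℤ}, IsDetVec v → ∀ i,
        v i = d ↔ 0 ≤ d ∧ (v i).toNat = d.toNat := by
      intro n v hv i
      have := hv.1 i
      omega
    simp only [hiff (hb k), hiff ha]
    by_cases hd : 0 ≤ d
    · simpa only [hd, true_and] using card_filter_eq_of_sum_pow_eq (hgen k) d.toNat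
    · simp [hd]
  rw [hb0 k]
  exact congrArg (fun w : Σ n, Fin n → ℤ => bettiCI w.1 a0 w.2) hsigma
end

section
/- Let a = (a_0, a_1, …, a_c) be a determining vector. If K(a) = Σ_{k=1}^{ℓ} r_k·K(a^{(k)}) for determining vectors a^{(1)}, …, a^{(ℓ)} and strictly positive rational numbers r_1, …, r_ℓ, then a^{(k)} = a for every k = 1, …, ℓ. (Equivalently, the ray generated by the Betti diagram of a complete intersection is extremal in the cone generated by all Betti diagrams of complete intersections.) -/
open Finset in
/-- Summing a function of `(|S|, a0 + Σ_{ℓ ∈ S} a ℓ)` over all subsets `S` is pairing it with the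
Betti diagram. -/
theorem sum_eq_sum_bettiCI_mul {c : ℕ} {a0 : ℤ} {a : Fin c → ℤ} (f : ℕ × ℤ → ℚ)
    {Q : Finset (ℕ × ℤ)} (hQ : ∀ S : Finset (Fin c), (S.card, a0 + ∑ ℓ ∈ S, a ℓ) ∈ Q) :
    ∑ S : Finset (Fin c), f (S.card, a0 + ∑ ℓ ∈ S, a ℓ) =
      ∑ q ∈ Q, (bettiCI c a0 a q : ℚ) * f q := by
  rw [← sum_fiberwise_of_maps_to (s := univ) (t := Q) fun S _ => hQ S]
  refine sum_congr rfl fun q _ => ?_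
  rw [sum_congr rfl (g := fun _ => f q) fun S hS => by rw [(mem_filter.1 hS).2]]
  simp [bettiCI, Prod.ext_iff]

theorem bettiCI_nonneg (c : ℕ) (a0 : ℤ) (a : Fin c → ℤ) (q : ℕ × ℤ) : 0 ≤ bettiCI c a0 a q := by
  simp [bettiCI]

theorem bettiCI_pos_iff {c : ℕ} {a0 : ℤ} {a : Fin c → ℤ} {q : ℕ × ℤ} :
    0 < bettiCI c a0 a q ↔ ∃ S : Finset (Fin c), S.card = q.1 ∧ a0 + ∑ ℓ ∈ S, a ℓ = q.2 := by
  simp [bettiCI, Finset.card_pos, Finset.filter_nonempty_iff]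

theorem sum_powerset_card_one_sq (c : ℕ) (a0 : ℤ) (a : Fin c → ℤ) :
    (∑ S : Finset (Fin c), if S.card = 1 then (((a0 + ∑ ℓ ∈ S, a ℓ : ℤ) : ℚ) - a0) ^ 2 else 0) =
      ∑ j, (a j : ℚ) ^ 2 := by
  rw [← Finset.sum_filter, ← Finset.powerset_univ, ← Finset.powersetCard_eq_filter,
    Finset.powersetCard_one, Finset.sum_map]
  simp

/-- Among the subsets of a given cardinality, an initial segment minimises the sum of a monotone
function. -/
theorem sum_filter_val_lt_le_sum {n : ℕ} {a : Fin n → ℤ} (ha : Monotone a) {i : ℕ}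
    {S : Finset (Fin n)} (hS : S.card = i) :
    ∑ j with j.val < i, a j ≤ ∑ j ∈ S, a j := by
  have hi : i ≤ n := by simpa [hS] using S.card_le_univ
  rcases Nat.eq_zero_or_pos i with rfl | hpos
  · simp [Finset.card_eq_zero.1 hS]
  set v := a ⟨i - 1, by omega⟩
  have hcard : (Finset.univ.filter fun j : Fin n => j.val < i).card = i := by
    simp [Fin.card_filter_val_lt, hi]
  have hT : ∑ j with j.val < i, (a j - v) = ∑ j, min (a j - v) 0 := by
    rw [Finset.sum_filter]
    refine Finset.sum_congr rfl fun j _ => ?_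
    split_ifs with h
    · have : a j ≤ v := ha (Fin.le_def.2 (by simp; omega))
      rw [min_eq_left (by linarith)]
    · have : v ≤ a j := ha (Fin.le_def.2 (by simp; omega))
      rw [min_eq_right (by linarith)]
  have h1 : ∑ j, min (a j - v) 0 ≤ ∑ j ∈ S, min (a j - v) 0 :=
    neg_le_neg_iff.1 <| by
      simpa only [← Finset.sum_neg_distrib] using Finset.sum_le_sum_of_subset_of_nonneg
        (f := fun j => -min (a j - v) 0) (Finset.subset_univ S) (by simp)
  have h2 : ∑ j ∈ S, min (a j - v) 0 ≤ ∑ j ∈ S, (a j - v) :=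
    Finset.sum_le_sum fun j _ => min_le_left _ _
  have h3 := (hT.trans_le h1).trans h2
  simp only [Finset.sum_sub_distrib, Finset.sum_const, hcard, hS] at h3
  linarith

/-- Abel summation for a sequence with nonpositive initial sums against a monotone sequence. -/
theorem mul_sum_le_sum_mul_of_initial_sums_nonpos {n : ℕ} {x b : Fin n → ℤ} (hb : Monotone b)
    (hx : ∀ i ≤ n, ∑ j with j.val < i, x j ≤ 0) {B : ℤ} (hB : ∀ j, b j ≤ B) :
    B * ∑ j, x j ≤ ∑ j, x j * b j := by
  induction n generalizing B with
  | zero => simp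
  | succ n ih =>
    have htot := hx (n + 1) le_rfl
    have hlast := hB (Fin.last n)
    have key := ih (x := fun j => x j.castSucc) (b := fun j => b j.castSucc)
      (B := b (Fin.last n)) (fun i j hij => hb (by simpa using hij))
      (fun i hi => by
        have := hx i (by omega)
        rw [Finset.sum_filter, Fin.sum_univ_castSucc] at this
        rw [Finset.sum_filter]
        simpa [Nat.not_lt.2 hi] using this)
      (fun j => hb (Fin.le_last _))
    rw [Finset.filter_true_of_mem (fun j _ => j.isLt)] at htot
    rw [Fin.sum_univ_castSucc] at htot ⊢
    rw [Fin.sum_univ_castSucc]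
    nlinarith

/-- If every (cardinality, sum) pair of a subset of `b` is attained by `a`, then `b` is majorised
by `a`, hence has a smaller sum of squares. -/
theorem sum_sq_add_sum_sub_sq_le {n : ℕ} {a b : Fin n → ℤ} (ha : Monotone a) (hb : Monotone b)
    (h : ∀ T : Finset (Fin n), ∃ S : Finset (Fin n),
      S.card = T.card ∧ ∑ j ∈ S, a j = ∑ j ∈ T, b j) :
    ∑ j, (b j) ^ 2 + ∑ j, (a j - b j) ^ 2 ≤ ∑ j, (a j) ^ 2 := by
  rcases n.eq_zero_or_pos with rfl | hn
  · simp
  have htot : ∑ j, (a j - b j) = 0 := by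
    obtain ⟨S, hS, hsum⟩ := h Finset.univ
    rw [Finset.card_univ, Finset.card_eq_iff_eq_univ] at hS
    rw [Finset.sum_sub_distrib, ← hsum, hS, sub_self]
  have hpre : ∀ i ≤ n, ∑ j with j.val < i, (a j - b j) ≤ 0 := by
    intro i hi
    obtain ⟨S, hS, hsum⟩ := h (Finset.univ.filter fun j => j.val < i)
    rw [Finset.sum_sub_distrib, ← hsum]
    rw [Fin.card_filter_val_lt, min_eq_right hi] at hS
    linarith [sum_filter_val_lt_le_sum ha hS]
  have key := mul_sum_le_sum_mul_of_initial_sums_nonpos hb hpre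
    (B := b ⟨n - 1, by omega⟩) (fun j => hb (Fin.le_def.2 (by simp; omega)))
  rw [htot, mul_zero] at key
  have hid : ∑ j, (a j) ^ 2 =
      ∑ j, (b j) ^ 2 + ∑ j, (a j - b j) ^ 2 + 2 * ∑ j, (a j - b j) * b j := by
    rw [Finset.mul_sum, ← Finset.sum_add_distrib, ← Finset.sum_add_distrib]
    exact Finset.sum_congr rfl fun j _ => by ring
  linarith

/-- A convex combination with positive weights attains an upper bound only if all terms do. -/
theorem eq_of_convex_combination_eq {ι : Type*} [Fintype ι] {r y : ι → ℚ} {Y : ℚ}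
    (hr : ∀ k, 0 < r k) (hsum : ∑ k, r k = 1) (hle : ∀ k, y k ≤ Y) (hY : Y = ∑ k, r k * y k)
    (k : ι) : y k = Y := by
  have h0 : ∑ k, r k * (Y - y k) = 0 := by
    simp only [mul_sub, Finset.sum_sub_distrib, ← Finset.sum_mul, hsum, ← hY]
    ring
  have := (Finset.sum_eq_zero_iff_of_nonneg fun k _ =>
    mul_nonneg (hr k).le (sub_nonneg.2 (hle k))).1 h0 k (Finset.mem_univ k)
  have := (mul_eq_zero.1 this).resolve_left (hr k).ne'
  linarith

theorem stmt1 (c : ℕ) (hc : 1 ≤ c) (a0 : ℤ) (a : Fin c → ℤ) (ha : IsDetVec a)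
    (l : ℕ) (r : Fin l → ℚ) (hr : ∀ k, 0 < r k)
    (c' : Fin l → ℕ) (hc' : ∀ k, 1 ≤ c' k)
    (b0 : Fin l → ℤ) (b : (k : Fin l) → Fin (c' k) → ℤ)
    (hb : ∀ k, IsDetVec (b k))
    (heq : ∀ q : ℕ × ℤ,
      (bettiCI c a0 a q : ℚ) = ∑ k, r k * (bettiCI (c' k) (b0 k) (b k) q : ℚ)) :
    ∀ k, ∃ h : c' k = c, b0 k = a0 ∧ ∀ j : Fin (c' k), b k j = a (Fin.cast h j) := by
  have hpair : ∀ f : ℕ × ℤ → ℚ, ∑ S : Finset (Fin c), f (S.card, a0 + ∑ ℓ ∈ S, a ℓ) =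
      ∑ k, r k * ∑ S : Finset (Fin (c' k)), f (S.card, b0 k + ∑ ℓ ∈ S, b k ℓ) := by
    intro f
    let Q : Finset (ℕ × ℤ) :=
      (Finset.univ.image fun S : Finset (Fin c) => (S.card, a0 + ∑ ℓ ∈ S, a ℓ)) ∪
      Finset.univ.biUnion fun k => Finset.univ.image
        fun S : Finset (Fin (c' k)) => (S.card, b0 k + ∑ ℓ ∈ S, b k ℓ)
    have hQa : ∀ S : Finset (Fin c), (S.card, a0 + ∑ ℓ ∈ S, a ℓ) ∈ Q := fun S =>
      Finset.mem_union_left _ (Finset.mem_image_of_mem _ (Finset.mem_univ S))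
    have hQb : ∀ k, ∀ S : Finset (Fin (c' k)), (S.card, b0 k + ∑ ℓ ∈ S, b k ℓ) ∈ Q :=
      fun k S => Finset.mem_union_right _ (Finset.mem_biUnion.2
        ⟨k, Finset.mem_univ k, Finset.mem_image_of_mem _ (Finset.mem_univ S)⟩)
    rw [sum_eq_sum_bettiCI_mul f hQa]
    simp only [fun k => sum_eq_sum_bettiCI_mul f (hQb k), heq, Finset.sum_mul, Finset.mul_sum,
      mul_assoc]
    exact Finset.sum_comm
  have hsupp : ∀ k, ∀ T : Finset (Fin (c' k)), ∃ S : Finset (Fin c),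
      S.card = T.card ∧ a0 + ∑ ℓ ∈ S, a ℓ = b0 k + ∑ ℓ ∈ T, b k ℓ := by
    intro k T
    refine (bettiCI_pos_iff (q := (T.card, b0 k + ∑ ℓ ∈ T, b k ℓ))).1 ?_
    have hpos : 0 < bettiCI (c' k) (b0 k) (b k) (T.card, b0 k + ∑ ℓ ∈ T, b k ℓ) :=
      bettiCI_pos_iff.2 ⟨T, rfl, rfl⟩
    rw [← Int.cast_pos (R := ℚ), heq]
    exact Finset.sum_pos' (fun k _ => mul_nonneg (hr k).le
        (Int.cast_nonneg (bettiCI_nonneg _ _ _ _)))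
      ⟨k, Finset.mem_univ k, mul_pos (hr k) (Int.cast_pos.2 hpos)⟩
  have hb0 : ∀ k, b0 k = a0 := by
    intro k
    obtain ⟨S, hS, h⟩ := hsupp k ∅
    rw [Finset.card_empty, Finset.card_eq_zero] at hS
    simpa [hS] using h.symm
  have hcle : ∀ k, c' k ≤ c := by
    intro k
    obtain ⟨S, hS, -⟩ := hsupp k Finset.univ
    simpa [hS] using S.card_le_univ
  have hsum : ∑ k, r k = 1 := by
    have := hpair fun q => if q.1 = 0 then 1 else 0
    simpa using this.symm
  have hc_eq : ∀ k, c' k = c := by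
    have h2 := hpair fun _ => 1
    simp only [Finset.sum_const, Finset.card_univ, Fintype.card_finset, Fintype.card_fin,
      nsmul_eq_mul, mul_one, Nat.cast_pow, Nat.cast_ofNat] at h2
    intro k
    have := eq_of_convex_combination_eq hr hsum
      (fun k => pow_le_pow_right₀ (by norm_num : (1 : ℚ) ≤ 2) (hcle k)) h2 k
    exact pow_right_injective₀ (by norm_num : (0 : ℚ) < 2) (by norm_num) this
  have hmaj : ∀ k, ∑ j, (b k j) ^ 2 + ∑ j, (a (Fin.cast (hc_eq k) j) - b k j) ^ 2 ≤
      ∑ j, (a j) ^ 2 := by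
    intro k
    rw [← (finCongr (hc_eq k)).sum_comp fun j => (a j) ^ 2]
    refine sum_sq_add_sum_sub_sq_le (a := fun j => a (Fin.cast (hc_eq k) j))
      (fun i j hij => ha.2 (by simpa using hij)) (hb k).2 fun T => ?_
    obtain ⟨S, hS, h⟩ := hsupp k T
    refine ⟨S.map (finCongr (hc_eq k).symm).toEmbedding, by simpa using hS, ?_⟩
    rw [hb0] at h
    simpa using h
  have hsq : ∀ k, ∑ j, ((b k j : ℤ) : ℚ) ^ 2 = ∑ j, (a j : ℚ) ^ 2 := by
    refine eq_of_convex_combination_eq hr hsum (fun k => ?_) ?_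
    · have : ∑ j, (b k j) ^ 2 ≤ ∑ j, (a j) ^ 2 :=
        (le_add_of_nonneg_right (Finset.sum_nonneg fun j _ => sq_nonneg _)).trans (hmaj k)
      exact_mod_cast this
    · have := hpair fun q => if q.1 = 1 then ((q.2 : ℚ) - a0) ^ 2 else 0
      simp only [hb0] at this
      simpa only [sum_powerset_card_one_sq] using this
  intro k
  refine ⟨hc_eq k, hb0 k, fun j => ?_⟩
  have hk : ∑ j, (b k j) ^ 2 = ∑ j, (a j) ^ 2 := by exact_mod_cast hsq k
  have hzero : ∑ j, (a (Fin.cast (hc_eq k) j) - b k j) ^ 2 = 0 :=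
    le_antisymm (by linarith [hmaj k]) (Finset.sum_nonneg fun j _ => sq_nonneg _)
  have := (Finset.sum_eq_zero_iff_of_nonneg fun j _ => sq_nonneg _).1 hzero j (Finset.mem_univ j)
  linarith [pow_eq_zero_iff (two_ne_zero) |>.1 this]
end

section
/- Let a = (a_0, a_1, …, a_c) be a determining vector and suppose K(a) = Σ_{k=1}^{ℓ} r_k·K(a^{(k)}) where each r_k is a strictly positive rational number and each a^{(k)} = (a_0^{(k)}, a_1^{(k)}, …, a_c^{(k)}) is a determining vector with the same codimension c and twist a_0^{(k)} = a_0. Then for every k, Σ_{j=1}^{c} a_j^{(k)} = Σ_{j=1}^{c} a_j. -/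
/-- In top homological degree `c` the diagram is supported at `a0 + ∑ j, a j`. -/
theorem bettiCI_top_pos_iff (c : ℕ) (a0 : ℤ) (a : Fin c → ℤ) (d : ℤ) :
    0 < bettiCI c a0 a (c, d) ↔ a0 + ∑ j, a j = d := by
  have h_univ (S : Finset (Fin c)) : S.card = c ↔ S = Finset.univ := by
    rw [← Finset.card_eq_iff_eq_univ, Fintype.card_fin]
  simp [bettiCI, Finset.card_pos, Finset.filter_nonempty_iff, h_univ]

theorem stmt3 (c : ℕ) (hc : 1 ≤ c) (a0 : ℤ) (a : Fin c → ℤ) (ha : IsDetVec a)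
    (l : ℕ) (r : Fin l → ℚ) (hr : ∀ k, 0 < r k)
    (b : Fin l → Fin c → ℤ) (hb : ∀ k, IsDetVec (b k))
    (heq : ∀ q : ℕ × ℤ,
      (bettiCI c a0 a q : ℚ) = ∑ k, r k * (bettiCI c a0 (b k) q : ℚ)) :
    ∀ k, ∑ j, b k j = ∑ j, a j := by
  intro k
  have hpos : (0 : ℚ) < bettiCI c a0 a (c, a0 + ∑ j, b k j) := by
    rw [heq]
    refine Finset.sum_pos' (fun i _ => mul_nonneg (hr i).le ?_)
      ⟨k, Finset.mem_univ k, mul_pos (hr k) ?_⟩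
    · exact_mod_cast bettiCI_nonneg c a0 (b i) _
    · exact_mod_cast (bettiCI_top_pos_iff c a0 (b k) _).2 rfl
  have h := (bettiCI_top_pos_iff c a0 a _).1 (by exact_mod_cast hpos)
  exact (add_left_cancel h).symm
end

section
/- Let v_1, …, v_s be vectors in ℤ^N. Then there exists a positive integer D such that for every γ ∈ ℤ^N: if γ = Σ_{k=1}^{s} a_k·v_k for some nonnegative rational numbers a_1, …, a_s, then there exist nonnegative integers b_1, …, b_s with D·γ = Σ_{k=1}^{s} b_k·v_k. -/
/-- A vector of nonnegative rational numbers has a common denominator. -/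
theorem exists_common_denominator {s : ℕ} (a : Fin s → ℚ) (ha : ∀ k, 0 ≤ a k) :
    ∃ d : ℕ, 0 < d ∧ ∃ b : Fin s → ℕ, ∀ k, (d : ℚ) * a k = b k := by
  refine ⟨∏ k, (a k).den, Finset.prod_pos fun k _ => (a k).den_pos,
    fun k => (∏ i ∈ Finset.univ.erase k, (a i).den) * (a k).num.toNat, fun k => ?_⟩
  have hnum : (((a k).num.toNat : ℕ) : ℚ) = (a k).num := by
    exact_mod_cast Int.toNat_of_nonneg (Rat.num_nonneg.mpr (ha k))
  rw [← Finset.prod_erase_mul _ _ (Finset.mem_univ k)]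
  push_cast
  rw [hnum, mul_assoc, Rat.den_mul_eq_num]

/-- Each integer vector of a rational cone has a positive multiple in the monoid spanned by
the generators. -/
theorem exists_multiple_of_cone {N s : ℕ} (v : Fin s → Fin N → ℤ) (γ : Fin N → ℤ) :
    ∃ d : ℕ, 0 < d ∧
      ((∃ a : Fin s → ℚ, (∀ k, 0 ≤ a k) ∧ ∀ j, (γ j : ℚ) = ∑ k, a k * (v k j : ℚ)) →
        ∃ b : Fin s → ℕ, ∀ j, (d : ℤ) * γ j = ∑ k, (b k : ℤ) * v k j) := by
  by_cases h : ∃ a : Fin s → ℚ, (∀ k, 0 ≤ a k) ∧ ∀ j, (γ j : ℚ) = ∑ k, a k * (v k j : ℚ)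
  · obtain ⟨a, ha, hγ⟩ := h
    obtain ⟨d, hd, b, hb⟩ := exists_common_denominator a ha
    refine ⟨d, hd, fun _ => ⟨b, fun j => ?_⟩⟩
    have : (d : ℚ) * γ j = ∑ k, (b k : ℚ) * v k j := by
      simp_rw [hγ, Finset.mul_sum, ← mul_assoc, hb]
    exact_mod_cast this
  · exact ⟨1, one_pos, fun hcone => absurd hcone h⟩

/-- The denominator is chosen uniformly over the finitely many integer vectors of the box that
contains all combinations with coefficients in `[0, 1)`. -/
theorem stmt7 (N s : ℕ) (v : Fin s → Fin N → ℤ) :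
    ∃ D : ℕ, 0 < D ∧
      ∀ γ : Fin N → ℤ,
        (∃ a : Fin s → ℚ, (∀ k, 0 ≤ a k) ∧
            ∀ j, (γ j : ℚ) = ∑ k, a k * (v k j : ℚ)) →
          ∃ b : Fin s → ℕ,
            ∀ j, (D : ℤ) * γ j = ∑ k, (b k : ℤ) * v k j := by
  choose d hd hmul using exists_multiple_of_cone v
  let B : Fin N → ℤ := fun j => ∑ k, |v k j|
  refine ⟨∏ δ ∈ Finset.Icc (-B) B, d δ, Finset.prod_pos fun δ _ => hd δ, ?_⟩
  rintro γ ⟨a, ha, hγ⟩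
  let δ : Fin N → ℤ := fun j => γ j - ∑ k, (⌊a k⌋₊ : ℤ) * v k j
  have hδ (j) : (δ j : ℚ) = ∑ k, (a k - ⌊a k⌋₊) * (v k j : ℚ) := by
    simp only [δ, Int.cast_sub, hγ, Int.cast_sum, Int.cast_mul, Int.cast_natCast, sub_mul,
      Finset.sum_sub_distrib]
  have hfrac_nonneg (k) : 0 ≤ a k - ⌊a k⌋₊ := sub_nonneg.mpr (Nat.floor_le (ha k))
  have hfrac_le (k) : a k - ⌊a k⌋₊ ≤ 1 := by linarith [Nat.lt_floor_add_one (a k)]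
  have habs (j) : |δ j| ≤ B j := by
    have : |(δ j : ℚ)| ≤ ∑ k, |(v k j : ℚ)| := by
      rw [hδ]
      refine (Finset.abs_sum_le_sum_abs _ _).trans (Finset.sum_le_sum fun k _ => ?_)
      rw [abs_mul, abs_of_nonneg (hfrac_nonneg k)]
      exact mul_le_of_le_one_left (abs_nonneg _) (hfrac_le k)
    exact_mod_cast this
  have hmem : δ ∈ Finset.Icc (-B) B :=
    Finset.mem_Icc.mpr ⟨fun j => (abs_le.mp (habs j)).1, fun j => (abs_le.mp (habs j)).2⟩
  obtain ⟨c, hc⟩ := Finset.dvd_prod_of_mem d hmem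
  obtain ⟨b, hb⟩ := hmul δ ⟨_, hfrac_nonneg, hδ⟩
  refine ⟨fun k => d δ * c * ⌊a k⌋₊ + c * b k, fun j => ?_⟩
  have hsplit : γ j = δ j + ∑ k, (⌊a k⌋₊ : ℤ) * v k j := by simp [δ]
  rw [hc, hsplit]
  push_cast
  simp only [add_mul, Finset.sum_add_distrib, mul_assoc, ← Finset.mul_sum]
  rw [← hb j]
  ring
end

section
/- The Betti diagram determines the determining vector: if a = (a_0, a_1, …, a_c) and b = (b_0, b_1, …, b_{c'}) are determining vectors with K(a) = K(b), then c = c' and a_j = b_j for all 0 ≤ j ≤ c. -/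
theorem bettiCI_zero (c : ℕ) (a0 : ℤ) (a : Fin c → ℤ) (d : ℤ) :
    bettiCI c a0 a (0, d) = if a0 = d then 1 else 0 := by
  have key : (Finset.univ.filter fun S : Finset (Fin c) =>
      S.card = 0 ∧ a0 + ∑ ℓ ∈ S, a ℓ = d) = if a0 = d then {∅} else ∅ := by
    ext S
    by_cases hS : S = ∅ <;> by_cases hd : a0 = d <;> simp [hS, hd]
  simp only [bettiCI, key]
  split_ifs <;> simp

theorem bettiCI_one (c : ℕ) (a0 : ℤ) (a : Fin c → ℤ) (d : ℤ) :
    bettiCI c a0 a (1, a0 + d) = ((Finset.univ.val.map a).count d : ℤ) := by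
  have key : (Finset.univ.filter fun S : Finset (Fin c) =>
      S.card = 1 ∧ a0 + ∑ ℓ ∈ S, a ℓ = a0 + d) =
      (Finset.univ.filter fun j => d = a j).map ⟨singleton, Finset.singleton_injective⟩ := by
    ext S
    simp only [Finset.mem_filter, Finset.mem_univ, true_and, Finset.mem_map,
      Function.Embedding.coeFn_mk, Finset.card_eq_one]
    constructor
    · rintro ⟨⟨j, rfl⟩, h⟩
      exact ⟨j, by simpa [eq_comm] using h, rfl⟩
    · rintro ⟨j, rfl, rfl⟩
      exact ⟨⟨j, rfl⟩, by simp⟩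
  simp only [bettiCI, key, Finset.card_map, Multiset.count_map]
  rfl

/-- A monotone tuple is determined by its multiset of values. -/
theorem Monotone.eq_of_univ_val_map_eq {α : Type*} [LinearOrder α] {n : ℕ}
    {a b : Fin n → α} (ha : Monotone a)
    (hb : Monotone b) (h : Finset.univ.val.map a = Finset.univ.val.map b) : a = b := by
  rw [Fin.univ_val_map, Fin.univ_val_map, Multiset.coe_eq_coe] at h
  exact List.ofFn_injective (h.eq_of_sortedLE ha.sortedLE_ofFn hb.sortedLE_ofFn)

theorem stmt10 (c : ℕ) (hc : 1 ≤ c) (a0 : ℤ) (a : Fin c → ℤ) (ha : IsDetVec a)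
    (c' : ℕ) (hc' : 1 ≤ c') (b0 : ℤ) (b : Fin c' → ℤ) (hb : IsDetVec b)
    (h : bettiCI c a0 a = bettiCI c' b0 b) :
    ∃ hcc : c = c', a0 = b0 ∧ ∀ j : Fin c, a j = b (Fin.cast hcc j) := by
  have h0 : a0 = b0 := by
    have := congrFun h (0, b0)
    rw [bettiCI_zero, bettiCI_zero] at this
    by_contra hne
    simp [hne] at this
  subst h0
  have hm : Finset.univ.val.map a = Finset.univ.val.map b := by
    ext d
    have := congrFun h (1, a0 + d)
    rw [bettiCI_one, bettiCI_one] at this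
    exact_mod_cast this
  have hcc : c = c' := by simpa using congrArg Multiset.card hm
  subst hcc
  exact ⟨rfl, rfl, congrFun (ha.2.eq_of_univ_val_map_eq hb.2 hm)⟩
end
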